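/- Let Ω be a finite set, let P be an ℓ-step probability distribution on Ω^ℓ with equal marginals π (with support all of Ω), write ρ := ρ(P), let j ∈ [ℓ], and let (X̄^{∖j}, Y, Z) be a double sample on step j from P. Then for every function f : Ω → ℝ, E[(f(Y) − f(Z))²] ≥ 2(1 − ρ²)·Var[f(Y)]. -/

import Mathlib

namespace SameSetHitting

/-- `P` is a probability distribution on a finite type. -/
def IsDist {α : Type} [Fintype α] (P : α → ℝ) : Prop :=
  (∀ x, 0 ≤ P x) ∧ ∑ x, P x = 1

open Classical in
/-- The `j`-th marginal of an `ℓ`-step distribution `P`. -/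
noncomputable def marginal {Ω : Type} [Fintype Ω] {ℓ : ℕ}
    (P : (Fin ℓ → Ω) → ℝ) (j : Fin ℓ) (a : Ω) : ℝ :=
  ∑ x : Fin ℓ → Ω, if x j = a then P x else 0

/-- All `ℓ` marginals of `P` are equal to `π`. -/
def HasMarginals {Ω : Type} [Fintype Ω] {ℓ : ℕ}
    (P : (Fin ℓ → Ω) → ℝ) (π : Ω → ℝ) : Prop :=
  ∀ j a, marginal P j a = π a

/-- The expectation `E[f(X)]` where `X` has the product law `πⁿ`. -/
noncomputable def exps {Ω : Type} [Fintype Ω] {n : ℕ}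
    (π : Ω → ℝ) (f : (Fin n → Ω) → ℝ) : ℝ :=
  ∑ v : Fin n → Ω, (∏ i, π (v i)) * f v

/-- `E[∏_{j} f_j(X^{(j)})]` where the tuples `(X_i^{(1)}, …, X_i^{(ℓ)})`,
`i = 1, …, n`, are i.i.d. with law `P` and `X^{(j)} = (X_1^{(j)}, …, X_n^{(j)})`. -/
noncomputable def prodExp {Ω : Type} [Fintype Ω] {ℓ n : ℕ}
    (P : (Fin ℓ → Ω) → ℝ) (f : Fin ℓ → ((Fin n → Ω) → ℝ)) : ℝ :=
  ∑ x : Fin ℓ → Fin n → Ω, (∏ i, P (fun j => x j i)) * ∏ j, f j (x j)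

/-- Expectation under the single-coordinate multi-step distribution `P`. -/
noncomputable def expP {Ω : Type} [Fintype Ω] {ℓ : ℕ}
    (P : (Fin ℓ → Ω) → ℝ) (f : (Fin ℓ → Ω) → ℝ) : ℝ :=
  ∑ x, P x * f x

/-- Covariance under `P`. -/
noncomputable def covP {Ω : Type} [Fintype Ω] {ℓ : ℕ}
    (P : (Fin ℓ → Ω) → ℝ) (f g : (Fin ℓ → Ω) → ℝ) : ℝ :=
  expP P (fun x => f x * g x) - expP P f * expP P g

/-- Variance under `P`. -/
noncomputable def varP {Ω : Type} [Fintype Ω] {ℓ : ℕ}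
    (P : (Fin ℓ → Ω) → ℝ) (f : (Fin ℓ → Ω) → ℝ) : ℝ :=
  covP P f f

/-- `f` depends only on the coordinates in `S`. -/
def DependsOn {Ω : Type} {ℓ : ℕ} (f : (Fin ℓ → Ω) → ℝ) (S : Finset (Fin ℓ)) : Prop :=
  ∀ x y : Fin ℓ → Ω, (∀ j ∈ S, x j = y j) → f x = f y

/-- The correlation `ρ(P, S, T)`. -/
noncomputable def rhoST {Ω : Type} [Fintype Ω] {ℓ : ℕ}
    (P : (Fin ℓ → Ω) → ℝ) (S T : Finset (Fin ℓ)) : ℝ :=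
  sSup {r : ℝ | ∃ f g : (Fin ℓ → Ω) → ℝ, DependsOn f S ∧ DependsOn g T ∧
    varP P f = 1 ∧ varP P g = 1 ∧ r = covP P f g}

/-- The correlation `ρ(P) = max_j ρ(P, {j}, [ℓ]∖{j})`. -/
noncomputable def rho {Ω : Type} [Fintype Ω] {ℓ : ℕ} (P : (Fin ℓ → Ω) → ℝ) : ℝ :=
  ⨆ j : Fin ℓ, rhoST P {j} ({j}ᶜ)

/-- Expectation under the single-step distribution `π`. -/
noncomputable def expPi {Ω : Type} [Fintype Ω] (π : Ω → ℝ) (f : Ω → ℝ) : ℝ :=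
  ∑ a, π a * f a

/-- Variance under the single-step distribution `π`. -/
noncomputable def varPi {Ω : Type} [Fintype Ω] (π : Ω → ℝ) (f : Ω → ℝ) : ℝ :=
  expPi π (fun a => (f a - expPi π f) ^ 2)

/-- The influence `Inf_i(f(X))` of coordinate `i`, where `X` has product law `πⁿ`. -/
noncomputable def influence {Ω : Type} [Fintype Ω] {n : ℕ}
    (π : Ω → ℝ) (i : Fin n) (f : (Fin n → Ω) → ℝ) : ℝ :=
  ∑ v : Fin n → Ω, (∏ k, π (v k)) * varPi π (fun a => f (Function.update v i a))

/-- The function obtained from `f` by applying the restriction `R`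
(`none` means unrestricted). -/
def restrict {Ω : Type} {n : ℕ} (R : Fin n → Option Ω)
    (f : (Fin n → Ω) → ℝ) : (Fin n → Ω) → ℝ :=
  fun x => f (fun i => (R i).getD (x i))

/-- The size (number of restricted coordinates) of a restriction. -/
def restSize {Ω : Type} {n : ℕ} (R : Fin n → Option Ω) : ℕ :=
  (Finset.univ.filter (fun i => (R i).isSome = true)).card

/-- `f` is `ε`-resilient up to size `k` (with respect to the product law `πⁿ`). -/
def Resilient {Ω : Type} [Fintype Ω] {n : ℕ} (π : Ω → ℝ) (ε : ℝ) (k : ℕ)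
    (f : (Fin n → Ω) → ℝ) : Prop :=
  ∀ R : Fin n → Option Ω, restSize R ≤ k →
    (1 - ε) * exps π f ≤ exps π (restrict R f) ∧
    exps π (restrict R f) ≤ (1 + ε) * exps π f

/-- The restriction operator `R[i,a]`. -/
def restrOp {Ω : Type} {n : ℕ} (i : Fin n) (a : Ω)
    (f : (Fin n → Ω) → ℝ) : (Fin n → Ω) → ℝ :=
  fun x => f (Function.update x i a)

/-- The maximum operator `M[i,y,z]`. -/
def maxOp {Ω : Type} {n : ℕ} (i : Fin n) (y z : Ω)
    (f : (Fin n → Ω) → ℝ) : (Fin n → Ω) → ℝ :=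
  fun x => max (f (Function.update x i y)) (f (Function.update x i z))

/-- Insert the value `a` at position `j` into `w : Ω^{[ℓ] ∖ {j}}`. -/
def ins {Ω : Type} {ℓ : ℕ} (j : Fin ℓ) (w : {k : Fin ℓ // k ≠ j} → Ω) (a : Ω) :
    Fin ℓ → Ω :=
  fun k => if h : k = j then a else w ⟨k, h⟩

/-- The probability that the coordinates other than `j` equal `w`. -/
noncomputable def margOff {Ω : Type} [Fintype Ω] {ℓ : ℕ}
    (P : (Fin ℓ → Ω) → ℝ) (j : Fin ℓ) (w : {k : Fin ℓ // k ≠ j} → Ω) : ℝ :=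
  ∑ a, P (ins j w a)

open Classical in
/-- The joint law of `(Y, Z)` for a double sample on step `j` from `P`. -/
noncomputable def doubleSample {Ω : Type} [Fintype Ω] {ℓ : ℕ}
    (P : (Fin ℓ → Ω) → ℝ) (j : Fin ℓ) (y z : Ω) : ℝ :=
  ∑ w : {k : Fin ℓ // k ≠ j} → Ω,
    if margOff P j w = 0 then 0
    else P (ins j w y) * P (ins j w z) / margOff P j w


/-- Splitting off the `j`-th coordinate. -/
def insEquiv {Ω : Type} {ℓ : ℕ} (j : Fin ℓ) :
    (({k : Fin ℓ // k ≠ j} → Ω) × Ω) ≃ (Fin ℓ → Ω) where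
  toFun p := ins j p.1 p.2
  invFun x := (fun k => x k.1, x j)
  left_inv p := by
    rcases p with ⟨w, a⟩
    ext k
    · simp [ins, k.2]
    · simp [ins]
  right_inv x := by
    ext k
    by_cases h : k = j
    · subst h; simp [ins]
    · simp [ins, h]

theorem ins_self {Ω : Type} {ℓ : ℕ} (j : Fin ℓ) (w : {k : Fin ℓ // k ≠ j} → Ω) (a : Ω) :
    ins j w a j = a := by simp [ins]

theorem ins_off {Ω : Type} {ℓ : ℕ} (j : Fin ℓ) (w : {k : Fin ℓ // k ≠ j} → Ω) (a : Ω) :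
    (fun k : {k : Fin ℓ // k ≠ j} => ins j w a k.1) = w := by
  ext k; simp [ins, k.2]

theorem expP_split {Ω : Type} [Fintype Ω] {ℓ : ℕ} (P : (Fin ℓ → Ω) → ℝ) (j : Fin ℓ)
    (h : (Fin ℓ → Ω) → ℝ) :
    expP P h = ∑ w : {k : Fin ℓ // k ≠ j} → Ω, ∑ a, P (ins j w a) * h (ins j w a) := by
  classical
  unfold expP
  rw [← Fintype.sum_prod_type', ← (insEquiv j).sum_comp]
  rfl

theorem expP_coord {Ω : Type} [Fintype Ω] {ℓ : ℕ} (P : (Fin ℓ → Ω) → ℝ) (π : Ω → ℝ)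
    (hm : HasMarginals P π) (j : Fin ℓ) (f : Ω → ℝ) :
    expP P (fun x => f (x j)) = expPi π f := by
  classical
  unfold expP expPi
  simp_rw [← hm j, marginal, Finset.sum_mul]
  rw [Finset.sum_comm]
  refine Finset.sum_congr rfl fun x _ => ?_
  simp [ite_mul]

theorem expP_linear {Ω : Type} [Fintype Ω] {ℓ : ℕ} (P : (Fin ℓ → Ω) → ℝ)
    (c d : ℝ) (f g : (Fin ℓ → Ω) → ℝ) :
    expP P (fun x => c * f x + d * g x) = c * expP P f + d * expP P g := by
  unfold expP
  rw [Finset.mul_sum, Finset.mul_sum, ← Finset.sum_add_distrib]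
  exact Finset.sum_congr rfl fun x _ => by ring

theorem expP_const {Ω : Type} [Fintype Ω] {ℓ : ℕ} (P : (Fin ℓ → Ω) → ℝ) (hP : IsDist P)
    (c : ℝ) : expP P (fun _ => c) = c := by
  unfold expP
  rw [← Finset.sum_mul, hP.2, one_mul]

theorem varP_eq {Ω : Type} [Fintype Ω] {ℓ : ℕ} (P : (Fin ℓ → Ω) → ℝ) (hP : IsDist P)
    (f : (Fin ℓ → Ω) → ℝ) : varP P f = expP P (fun x => (f x - expP P f) ^ 2) := by
  set μ := expP P f with hμ
  have h1 : (fun x => (f x - μ) ^ 2)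
      = fun x => 1 * (f x * f x) + 1 * ((-2 * μ) * f x + 1 * μ ^ 2) := by
    ext x; ring
  rw [h1, expP_linear P 1 1 (fun x => f x * f x) (fun x => (-2 * μ) * f x + 1 * μ ^ 2),
    expP_linear P (-2 * μ) 1 f (fun _ => μ ^ 2), expP_const P hP]
  unfold varP covP
  rw [← hμ]; ring

theorem varP_nonneg {Ω : Type} [Fintype Ω] {ℓ : ℕ} (P : (Fin ℓ → Ω) → ℝ) (hP : IsDist P)
    (f : (Fin ℓ → Ω) → ℝ) : 0 ≤ varP P f := by
  rw [varP_eq P hP]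
  exact Finset.sum_nonneg fun x _ => mul_nonneg (hP.1 x) (sq_nonneg _)

theorem varP_sub {Ω : Type} [Fintype Ω] {ℓ : ℕ} (P : (Fin ℓ → Ω) → ℝ)
    (f g : (Fin ℓ → Ω) → ℝ) :
    varP P (fun x => 1 * f x + (-1) * g x) = varP P f + varP P g - 2 * covP P f g := by
  have h1 : (fun x => (1 * f x + (-1) * g x) * (1 * f x + (-1) * g x))
      = fun x => 1 * (f x * f x) + 1 * (1 * (g x * g x) + (-2) * (f x * g x)) := by
    ext x; ring
  unfold varP covP
  rw [h1, expP_linear P 1 1 (fun x => f x * f x)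
      (fun x => 1 * (g x * g x) + (-2) * (f x * g x)),
    expP_linear P 1 (-2) (fun x => g x * g x) (fun x => f x * g x), expP_linear P 1 (-1) f g]
  ring

theorem covP_smul {Ω : Type} [Fintype Ω] {ℓ : ℕ} (P : (Fin ℓ → Ω) → ℝ) (c d : ℝ)
    (f g : (Fin ℓ → Ω) → ℝ) :
    covP P (fun x => c * f x) (fun x => d * g x) = c * d * covP P f g := by
  have h (c : ℝ) (f : (Fin ℓ → Ω) → ℝ) : expP P (fun x => c * f x) = c * expP P f := by
    simpa using expP_linear P c 0 f f
  have h1 : (fun x => c * f x * (d * g x)) = fun x => (c * d) * (f x * g x) := by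
    ext x; ring
  unfold covP
  rw [h1, h (c * d) (fun x => f x * g x), h, h]
  ring

theorem le_rho {Ω : Type} [Fintype Ω] {ℓ : ℕ} (P : (Fin ℓ → Ω) → ℝ) (hP : IsDist P)
    (j : Fin ℓ) (f g : (Fin ℓ → Ω) → ℝ) (hf : DependsOn f {j}) (hg : DependsOn g ({j}ᶜ))
    (vf : varP P f = 1) (vg : varP P g = 1) : covP P f g ≤ rho P := by
  have h1 : covP P f g ≤ rhoST P {j} ({j}ᶜ) := by
    refine le_csSup ⟨1, ?_⟩ ⟨f, g, hf, hg, vf, vg, rfl⟩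
    rintro r ⟨f, g, -, -, h1, h2, rfl⟩
    have := varP_nonneg P hP (fun x => 1 * f x + (-1) * g x)
    rw [varP_sub, h1, h2] at this
    linarith
  exact h1.trans (le_ciSup (f := fun j : Fin ℓ => rhoST P {j} ({j}ᶜ))
    (Set.finite_range _).bddAbove j)

/-- Conditional expectation of `f` at coordinate `j` given the others. -/
noncomputable def condE {Ω : Type} [Fintype Ω] {ℓ : ℕ}
    (P : (Fin ℓ → Ω) → ℝ) (j : Fin ℓ) (f : Ω → ℝ) (w : {k : Fin ℓ // k ≠ j} → Ω) : ℝ :=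
  (∑ a, P (ins j w a) * f a) / margOff P j w

theorem condE_spec {Ω : Type} [Fintype Ω] {ℓ : ℕ} (P : (Fin ℓ → Ω) → ℝ) (hP : IsDist P)
    (j : Fin ℓ) (f : Ω → ℝ) (w : {k : Fin ℓ // k ≠ j} → Ω) :
    ∑ a, P (ins j w a) * f a = margOff P j w * condE P j f w := by
  unfold condE
  by_cases h : margOff P j w = 0
  · rw [h, zero_mul]
    have := (Finset.sum_eq_zero_iff_of_nonneg (fun a _ => hP.1 (ins j w a))).1 h
    exact Finset.sum_eq_zero fun a ha => by rw [this a ha, zero_mul]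
  · field_simp

theorem expP_mul_condE {Ω : Type} [Fintype Ω] {ℓ : ℕ} (P : (Fin ℓ → Ω) → ℝ) (hP : IsDist P)
    (j : Fin ℓ) (f : Ω → ℝ) (u : ({k : Fin ℓ // k ≠ j} → Ω) → ℝ) :
    expP P (fun x => f (x j) * u (fun k => x k.1))
      = expP P (fun x => condE P j f (fun k => x k.1) * u (fun k => x k.1)) := by
  rw [expP_split P j, expP_split P j]
  refine Finset.sum_congr rfl fun w _ => ?_
  simp only [ins_self, ins_off]
  simp_rw [← mul_assoc]
  rw [← Finset.sum_mul, ← Finset.sum_mul, condE_spec P hP, ← Finset.sum_mul]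
  rfl

theorem double_eq {Ω : Type} [Fintype Ω] {ℓ : ℕ} (P : (Fin ℓ → Ω) → ℝ) (hP : IsDist P)
    (j : Fin ℓ) (f : Ω → ℝ) :
    ∑ y : Ω, ∑ z : Ω, doubleSample P j y z * (f y - f z) ^ 2
      = 2 * (expP P (fun x => f (x j) * f (x j))
        - expP P (fun x => condE P j f (fun k => x k.1) * condE P j f (fun k => x k.1))) := by
  classical
  rw [expP_split P j, expP_split P j, ← Finset.sum_sub_distrib, Finset.mul_sum]
  simp only [ins_self, ins_off, doubleSample, Finset.sum_mul]
  simp_rw [Finset.sum_comm (s := (Finset.univ : Finset Ω))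
    (t := (Finset.univ : Finset ({k : Fin ℓ // k ≠ j} → Ω)))]
  refine Finset.sum_congr rfl fun w _ => ?_
  rw [← Finset.sum_mul]
  change _ = 2 * (_ - margOff P j w * _)
  by_cases h : margOff P j w = 0
  · have h0 := (Finset.sum_eq_zero_iff_of_nonneg (fun a _ => hP.1 (ins j w a))).1 h
    have h1 : ∀ a, P (ins j w a) = 0 := fun a => h0 a (Finset.mem_univ a)
    simp [h, h1]
  · simp only [h, if_false]
    have e : ∀ y z, P (ins j w y) * P (ins j w z) / margOff P j w * (f y - f z) ^ 2
        = (margOff P j w)⁻¹ * ((P (ins j w y) * (f y * f y)) * P (ins j w z)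
          + P (ins j w y) * (P (ins j w z) * (f z * f z))
          - 2 * ((P (ins j w y) * f y) * (P (ins j w z) * f z))) := by
      intro y z; field_simp; ring
    simp_rw [e, ← Finset.mul_sum, Finset.sum_sub_distrib, Finset.sum_add_distrib,
      ← Finset.mul_sum, ← Finset.sum_mul]
    rw [condE_spec P hP j f w]
    change (margOff P j w)⁻¹ * (_ * margOff P j w + margOff P j w * _ - _) = _
    field_simp
    ring

/-- for a double sample `(Y,Z)` on step `j`,
`E[(f(Y) − f(Z))²] ≥ 2(1 − ρ(P)²)·Var[f(Y)]`. -/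
theorem double_sample_variance_bound
    {Ω : Type} [Fintype Ω] {ℓ : ℕ}
    (P : (Fin ℓ → Ω) → ℝ) (π : Ω → ℝ)
    (hP : IsDist P) (hm : HasMarginals P π) (hπ : ∀ a : Ω, 0 < π a)
    (j : Fin ℓ) (f : Ω → ℝ) :
    2 * (1 - rho P ^ 2) * varPi π f ≤
      ∑ y : Ω, ∑ z : Ω, doubleSample P j y z * (f y - f z) ^ 2 := by
  set F : (Fin ℓ → Ω) → ℝ := fun x => f (x j) with hF
  set G : (Fin ℓ → Ω) → ℝ := fun x => condE P j f (fun k => x k.1) with hG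
  have hvar : varPi π f = varP P F := by
    rw [varP_eq P hP, hF, expP_coord P π hm j f]
    exact (expP_coord P π hm j (fun a => (f a - expPi π f) ^ 2)).symm
  have hE : expP P F = expP P G := by
    simpa using expP_mul_condE P hP j f (fun _ => 1)
  have hFG : expP P (fun x => F x * G x) = expP P (fun x => G x * G x) :=
    expP_mul_condE P hP j f (condE P j f)
  have hcov : covP P F G = varP P G := by
    unfold varP covP; rw [hFG, hE]
  have hD : ∑ y : Ω, ∑ z : Ω, doubleSample P j y z * (f y - f z) ^ 2
      = 2 * (varP P F - varP P G) := by
    rw [double_eq P hP j f]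
    unfold varP covP
    rw [hE]; ring
  rw [hD, hvar]
  suffices h : varP P G ≤ rho P ^ 2 * varP P F by nlinarith
  have hF0 := varP_nonneg P hP F
  rcases (varP_nonneg P hP G).eq_or_lt with hG0 | hG0
  · rw [← hG0]; positivity
  have hsub := varP_nonneg P hP (fun x => 1 * F x + (-1) * G x)
  rw [varP_sub, hcov] at hsub
  have hF1 : 0 < varP P F := by linarith
  set s := √(varP P F) with hs
  set t := √(varP P G) with ht
  have hs0 : 0 < s := Real.sqrt_pos.2 hF1
  have ht0 : 0 < t := Real.sqrt_pos.2 hG0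
  have hs2 : varP P F = s ^ 2 := (Real.sq_sqrt hF0).symm
  have ht2 : varP P G = t ^ 2 := (Real.sq_sqrt hG0.le).symm
  have key := le_rho P hP j (fun x => s⁻¹ * F x) (fun x => t⁻¹ * G x)
    (fun x y h => by simp [hF, h j (by simp)])
    (fun x y h => by
      have : (fun k : {k : Fin ℓ // k ≠ j} => x k.1) = fun k => y k.1 := by
        ext k; exact h k.1 (by simp [k.2])
      simp only [hG, this])
    (by
      change covP P _ _ = 1
      rw [covP_smul]
      change _ * varP P F = 1
      rw [hs2]; field_simp)
    (by
      change covP P _ _ = 1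
      rw [covP_smul]
      change _ * varP P G = 1
      rw [ht2]; field_simp)
  rw [covP_smul, hcov, ht2] at key
  have key2 : t ≤ rho P * s := by
    have : s⁻¹ * t⁻¹ * t ^ 2 = t / s := by field_simp
    rw [this, div_le_iff₀ hs0] at key
    exact key
  rw [ht2, hs2, ← mul_pow]
  exact pow_le_pow_left₀ ht0.le key2 2

end SameSetHitting
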